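/- arXiv:2310.18751 — 7 statements merged into one kernel-verified Lean document; each statement's English description precedes it below -/
import Mathlib

section
/- Let n ≥ 1, d ≥ 2, q ∈ ℂ^×, and let R be a commutative ℂ-algebra containing invertible elements x_1,…,x_n such that x_i − x_j and x_i x_j^{−1} − q are invertible for i ≠ j, together with elements a_i^α, b_i^α (1 ≤ i ≤ n, 1 ≤ α ≤ d) satisfying Σ_{α=1}^d a_i^α = 1 for each i. Let z⁻ be the antisymmetric d×d matrix with z⁻_{αβ} = 1/2 for α < β, i.e. z⁻_{αβ} = (1/2)o(α,β), and set G_{z⁻}(i,j;α,β) := (1/2)o(α,β) + (1/2)Σ_{γ=1}^d (o(γ,α) a_j^γ − o(γ,β) a_i^γ) + (1/2)Σ_{γ,ε=1}^d o(γ,ε) a_i^γ a_j^ε. Then, with {−,−}₀ the Chalykh–Fairon bracket formulas and {−,−}_− the Arutyunov–Olivucci minus bracket formulas as given in the context, the following identities hold in R: {a_i^α, a_j^β}_− − {a_i^α, a_j^β}₀ = G_{z⁻}(i,j;α,β) a_i^α a_j^β; {a_i^α, b_j^β}_− − {a_i^α, b_j^β}₀ = −G_{z⁻}(i,j;α,β)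 a_i^α b_j^β; {b_i^α, b_j^β}_− − {b_i^α, b_j^β}₀ = G_{z⁻}(i,j;α,β) b_i^α b_j^β; and the two brackets agree on every pair involving some x_i. Hence the Poisson structures of Arutyunov–Olivucci and of Chalykh–Fairon on the local parametrization of the trigonometric spin Ruijsenaars–Schneider phase space differ by ψ_{z⁻} and belong to a common Poisson pencil (Proposition 4.5; Theorem B of the paper). -/
set_option linter.unusedVariables false

open Finset

noncomputable section

/-- The skewsymmetric ordering sign `o(α,β)`: `+1` if `α < β`, `−1` if `β < α`, `0` else. -/
def oS {d : ℕ} (α β : Fin d) : ℂ := if α < β then 1 else if β < α then -1 else 0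

variable {R : Type*} [CommRing R] [Algebra ℂ R]

/-- The element `Z_{ij} = q (Σ_β a_i^β b_j^β)/(x_i x_j^{−1} − q)`. -/
def Zel {n d : ℕ} (q : ℂ) (x : Fin n → R) (a b : Fin n → Fin d → R) (i j : Fin n) : R :=
  algebraMap ℂ R q * (∑ β, a i β * b j β) *
    Ring.inverse (x i * Ring.inverse (x j) - algebraMap ℂ R q)

/-- The coefficient `δ_{(i≠j)} (x_i + x_j)/(x_i − x_j)`. -/
def cxx {n : ℕ} (x : Fin n → R) (i j : Fin n) : R :=
  if i = j then 0 else (x i + x j) * Ring.inverse (x i - x j)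

/-! ### The Chalykh–Fairon bracket `{−,−}₀` on generators -/

def CF0_xx {n : ℕ} (x : Fin n → R) (i j : Fin n) : R := 0

def CF0_xa {n d : ℕ} (x : Fin n → R) (a : Fin n → Fin d → R) (i j : Fin n) (α : Fin d) :
    R := 0

def CF0_xb {n d : ℕ} (x : Fin n → R) (b : Fin n → Fin d → R) (i j : Fin n) (α : Fin d) :
    R := if i = j then x i * b j α else 0

def CF0_aa {n d : ℕ} (x : Fin n → R) (a : Fin n → Fin d → R) (i j : Fin n) (α β : Fin d) :
    R :=
  (2 : ℂ)⁻¹ • (cxx x i j * (a i α * a j β + a j α * a i β - a j α * a j β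
      - a i α * a i β))
  + ((2 : ℂ)⁻¹ * oS β α) • (a i α * a j β + a j α * a i β)
  + (2 : ℂ)⁻¹ • (∑ γ, oS α γ • (a j β * (a i α * a j γ + a j α * a i γ)))
  - (2 : ℂ)⁻¹ • (∑ γ, oS β γ • (a i α * (a j β * a i γ + a i β * a j γ)))

def CF0_ab {n d : ℕ} (q : ℂ) (x : Fin n → R) (a b : Fin n → Fin d → R)
    (i j : Fin n) (α β : Fin d) : R :=
  a i α * Zel q x a b i j - (if α = β then Zel q x a b i j else 0)
  - (2 : ℂ)⁻¹ • (cxx x i j * ((a i α - a j α) * b j β))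
  + (if α < β then a i α * b j β else 0)
  + a i α * ∑ γ ∈ Finset.univ.filter (· < β), a i γ * (b j γ - b j β)
  - (if α = β then ∑ γ ∈ Finset.univ.filter (· < β), a i γ * b j γ else 0)
  - (2 : ℂ)⁻¹ • (∑ γ, oS α γ • (b j β * (a i α * a j γ + a j α * a i γ)))

def CF0_bb {n d : ℕ} (q : ℂ) (x : Fin n → R) (a b : Fin n → Fin d → R)
    (i j : Fin n) (α β : Fin d) : R :=
  (2 : ℂ)⁻¹ • (cxx x i j * (b i α * b j β + b j α * b i β))
  - b i α * Zel q x a b i j + b j β * Zel q x a b j i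
  + ((2 : ℂ)⁻¹ * oS β α) • (b i α * b j β - b j α * b i β)
  - b i α * ∑ γ ∈ Finset.univ.filter (· < β), a i γ * (b j γ - b j β)
  + b j β * ∑ γ ∈ Finset.univ.filter (· < α), a j γ * (b i γ - b i α)

/-! ### The Arutyunov–Olivucci minus bracket `{−,−}_−` on generators -/

def AOm_xx {n : ℕ} (x : Fin n → R) (i j : Fin n) : R := 0

def AOm_xa {n d : ℕ} (x : Fin n → R) (a : Fin n → Fin d → R) (i j : Fin n) (α : Fin d) :
    R := 0

def AOm_xb {n d : ℕ} (x : Fin n → R) (b : Fin n → Fin d → R) (i j : Fin n) (α : Fin d) :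
    R := if i = j then x i * b j α else 0

def AOm_aa {n d : ℕ} (x : Fin n → R) (a : Fin n → Fin d → R) (i j : Fin n) (α β : Fin d) :
    R :=
  (2 : ℂ)⁻¹ • (cxx x i j * (a i α * a j β + a j α * a i β - a j α * a j β
      - a i α * a i β))
  + ((2 : ℂ)⁻¹ * oS β α) • (a j α * a i β)
  + (2 : ℂ)⁻¹ • (∑ γ, oS α γ • (a j β * a j α * a i γ))
  - (2 : ℂ)⁻¹ • (∑ γ, oS β γ • (a i α * a i β * a j γ))
  + (2 : ℂ)⁻¹ • ((∑ γ, ∑ ε, oS ε γ • (a i ε * a j γ)) * (a i α * a j β))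

def AOm_ab {n d : ℕ} (q : ℂ) (x : Fin n → R) (a b : Fin n → Fin d → R)
    (i j : Fin n) (α β : Fin d) : R :=
  a i α * Zel q x a b i j - (if α = β then Zel q x a b i j else 0)
  - (2 : ℂ)⁻¹ • (cxx x i j * ((a i α - a j α) * b j β))
  + a i α * ∑ γ ∈ Finset.univ.filter (· < β), a i γ * b j γ
  - (if α = β then ∑ γ ∈ Finset.univ.filter (· < β), a i γ * b j γ else 0)
  - (2 : ℂ)⁻¹ • (∑ γ, oS α γ • (b j β * a j α * a i γ))
  - (2 : ℂ)⁻¹ • ((∑ γ, ∑ ε, oS ε γ • (a i ε * a j γ)) * (a i α * b j β))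
  + (2 : ℂ)⁻¹ • (a i α * a i β * b j β)
  - (if α = β then (2 : ℂ)⁻¹ • (a i α * b j β) else 0)

def AOm_bb {n d : ℕ} (q : ℂ) (x : Fin n → R) (a b : Fin n → Fin d → R)
    (i j : Fin n) (α β : Fin d) : R :=
  (2 : ℂ)⁻¹ • (cxx x i j * (b i α * b j β + b j α * b i β))
  - b i α * Zel q x a b i j + b j β * Zel q x a b j i
  - ((2 : ℂ)⁻¹ * oS β α) • (b j α * b i β)
  - b i α * ∑ γ ∈ Finset.univ.filter (· < β), a i γ * b j γ
  + b j β * ∑ γ ∈ Finset.univ.filter (· < α), a j γ * b i γ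
  + (2 : ℂ)⁻¹ • ((∑ γ, ∑ ε, oS ε γ • (a i ε * a j γ)) * (b i α * b j β))
  + (2 : ℂ)⁻¹ • ((a j α - a i β) * (b i α * b j β))

/-- The function `G_{z⁻}(i,j;α,β)` for the antisymmetric matrix `z⁻_{αβ} = (1/2)o(α,β)`:
`G_{z⁻} = (1/2)o(α,β) + (1/2)Σ_γ (o(γ,α)a_j^γ − o(γ,β)a_i^γ)
+ (1/2)Σ_{γ,ε} o(γ,ε) a_i^γ a_j^ε`. -/
def Gminus {n d : ℕ} (a : Fin n → Fin d → R) (i j : Fin n) (α β : Fin d) : R :=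
  ((2 : ℂ)⁻¹ * oS α β) • (1 : R)
  + (2 : ℂ)⁻¹ • (∑ γ, (oS γ α • a j γ - oS γ β • a i γ))
  + (2 : ℂ)⁻¹ • (∑ γ, ∑ ε, oS γ ε • (a i γ * a j ε))

end

theorem oS_swap {d : ℕ} (α β : Fin d) : oS β α = -oS α β := by
  unfold oS
  rcases lt_trichotomy α β with h | h | h
  · simp [h, h.not_gt]
  · simp [h]
  · simp [h, h.not_gt]

/-- The sign `o(α,β)` in terms of the indicators of `α < β` and `α = β`. -/
theorem oS_eq_indicators {d : ℕ} (α β : Fin d) :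
    oS α β = 2 * (if α < β then 1 else 0) + (if α = β then 1 else 0) - 1 := by
  unfold oS
  rcases lt_trichotomy α β with h | h | h
  · simp [h, h.ne]; norm_num
  · simp [h]
  · simp [h, h.not_gt, h.ne']

theorem sum_filter_mul_sub_const {R : Type*} [CommRing R] {d : ℕ} (f g : Fin d → R) (β : Fin d) :
    ∑ γ ∈ Finset.univ.filter (· < β), f γ * (g γ - g β)
      = ∑ γ ∈ Finset.univ.filter (· < β), f γ * g γ
        - (∑ γ ∈ Finset.univ.filter (· < β), f γ) * g β := by
  simp only [mul_sub, Finset.sum_sub_distrib, Finset.sum_mul]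

section

variable {R : Type*} [CommRing R] [Algebra ℂ R] {d : ℕ}

/-- Partial sums of a family with total sum `1`, through the ordering sign. -/
theorem sum_lt_eq_half_smul (f : Fin d → R) (hf : ∑ γ, f γ = 1) (β : Fin d) :
    ∑ γ ∈ Finset.univ.filter (· < β), f γ
      = (2 : ℂ)⁻¹ • (1 + ∑ γ, oS γ β • f γ - f β) := by
  have h : ∑ γ, oS γ β • f γ
      = (2 : ℂ) • ∑ γ ∈ Finset.univ.filter (· < β), f γ + f β - 1 := by
    simp only [oS_eq_indicators, sub_smul, add_smul, mul_smul, one_smul, ite_smul, zero_smul,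
      Finset.sum_sub_distrib, Finset.sum_add_distrib, ← Finset.smul_sum, hf, Finset.sum_ite_eq',
      Finset.mem_univ, if_true, Finset.sum_filter]
  rw [h]
  module

theorem sum_oS_smul_mul (f : Fin d → R) (α : Fin d) (r : R) :
    ∑ γ, oS α γ • (r * f γ) = -(r * ∑ γ, oS γ α • f γ) := by
  simp only [oS_swap _ α, neg_smul, Finset.sum_neg_distrib, Finset.mul_sum, mul_smul_comm]

theorem sum_oS_smul_mul_add (f g : Fin d → R) (α : Fin d) (s t : R) :
    ∑ γ, oS γ α • (s * f γ + t * g γ)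
      = s * ∑ γ, oS γ α • f γ + t * ∑ γ, oS γ α • g γ := by
  simp only [smul_add, Finset.sum_add_distrib, Finset.mul_sum, mul_smul_comm]

theorem Gminus_eq {n : ℕ} (a : Fin n → Fin d → R) (i j : Fin n) (α β : Fin d) :
    Gminus a i j α β = ((2 : ℂ)⁻¹ * oS α β) • (1 : R)
      + (2 : ℂ)⁻¹ • (∑ γ, oS γ α • a j γ - ∑ γ, oS γ β • a i γ)
      + (2 : ℂ)⁻¹ • (∑ γ, ∑ ε, oS ε γ • (a i ε * a j γ)) := by
  rw [Gminus, Finset.sum_sub_distrib]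
  congr 2
  exact Finset.sum_comm

end

/-- **Compatibility of the Arutyunov–Olivucci and Chalykh–Fairon Poisson structures**
(Proposition 4.5 / Theorem B of the paper): on the local parametrization of the
trigonometric spin Ruijsenaars–Schneider phase space, the minus bracket of
Arutyunov–Olivucci differs from the Chalykh–Fairon bracket exactly by `ψ_{z⁻}`,
i.e. `{·,·}_− − {·,·}₀ = ±G_{z⁻}·(products)` on generators, and the two brackets agree
on all pairs involving the `x_i`; hence they belong to a common Poisson pencil. -/
theorem AO_CF_brackets_compatible
    {R : Type*} [CommRing R] [Algebra ℂ R] {n d : ℕ} (hn : 1 ≤ n) (hd : 2 ≤ d)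
    (q : ℂ) (hq : q ≠ 0)
    (x : Fin n → R) (a b : Fin n → Fin d → R)
    (hx : ∀ i, IsUnit (x i))
    (hxx : ∀ i j, i ≠ j → IsUnit (x i - x j))
    (hxq : ∀ i j, i ≠ j → IsUnit (x i * Ring.inverse (x j) - algebraMap ℂ R q))
    (hsum : ∀ i, (∑ α, a i α) = 1) :
    (∀ (i j : Fin n) (α β : Fin d),
      AOm_aa x a i j α β - CF0_aa x a i j α β = Gminus a i j α β * (a i α * a j β)) ∧
    (∀ (i j : Fin n) (α β : Fin d),
      AOm_ab q x a b i j α β - CF0_ab q x a b i j α β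
        = - (Gminus a i j α β * (a i α * b j β))) ∧
    (∀ (i j : Fin n) (α β : Fin d),
      AOm_bb q x a b i j α β - CF0_bb q x a b i j α β
        = Gminus a i j α β * (b i α * b j β)) ∧
    (∀ i j : Fin n, AOm_xx x i j = CF0_xx x i j) ∧
    (∀ (i j : Fin n) (α : Fin d), AOm_xa x a i j α = CF0_xa x a i j α) ∧
    (∀ (i j : Fin n) (α : Fin d), AOm_xb x b i j α = CF0_xb x b i j α) := by
  refine ⟨fun i j α β => ?_, fun i j α β => ?_, fun i j α β => ?_, fun _ _ => rfl,
    fun _ _ _ => rfl, fun _ _ _ => rfl⟩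
  · simp only [AOm_aa, CF0_aa, Gminus_eq, sum_oS_smul_mul, sum_oS_smul_mul_add, oS_swap α β]
    simp only [Algebra.smul_def, map_mul, map_neg]
    ring
  · have hδ : (if α < β then a i α * b j β else 0)
        = (2 : ℂ)⁻¹ • ((1 + oS α β) • (a i α * b j β))
          - (if α = β then (2 : ℂ)⁻¹ • (a i α * b j β) else 0) := by
      rw [oS_eq_indicators]
      split_ifs <;> module
    simp only [AOm_ab, CF0_ab, Gminus_eq, sum_oS_smul_mul, sum_oS_smul_mul_add,
      sum_filter_mul_sub_const, sum_lt_eq_half_smul (a i) (hsum i), hδ]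
    simp only [Algebra.smul_def, map_mul, map_add, map_one]
    ring
  · simp only [AOm_bb, CF0_bb, Gminus_eq, sum_filter_mul_sub_const,
      sum_lt_eq_half_smul (a i) (hsum i), sum_lt_eq_half_smul (a j) (hsum j), oS_swap α β]
    simp only [Algebra.smul_def, map_mul, map_neg]
    ring
end

section
/- Let n, d ≥ 1 and let R be a commutative ℂ-algebra generated by the entries of matrices Z ∈ Mat_{n×n}(R), W_α ∈ Mat_{n×1}(R) and V_α ∈ Mat_{1×n}(R) for 1 ≤ α ≤ d. Let (z_{αβ})_{1≤α,β≤d} be an antisymmetric complex matrix and ψ : R × R → R an antisymmetric ℂ-bilinear biderivation satisfying: ψ(Z_{ij}, r) = 0 for all r ∈ R; ψ((V_α)_i, (V_β)_j) = z_{αβ} (V_α)_i (V_β)_j; ψ((W_α)_i, (W_β)_j) = z_{αβ} (W_α)_i (W_β)_j; ψ((V_α)_i, (W_β)_j) = −z_{αβ} (V_α)_i (W_β)_j. Then: (i) every entry of each product W_γ V_γ is a Casimir, i.e. ψ((W_γ V_γ)_{ij}, r) = 0 for all r ∈ R; consequently, with 𝒵_α := Z + Σ_{β=1}^α W_β V_β,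 one has ψ(tr(𝒵_α^k), tr(𝒵_β^l)) = 0 for all k, l ≥ 1 and all α, β; (ii) with t_{k;αβ} := tr(W_α V_β Z^k), one has ψ(t_{k;γε}, t_{l;αβ}) = (z_{γα} + z_{εβ} − z_{γβ} − z_{εα}) · t_{k;γε} · t_{l;αβ}. -/
open Finset Matrix

/-- A ℂ-bilinear biderivation on a commutative ℂ-algebra. -/
def IsCBiderivation {R : Type*} [CommRing R] [Algebra ℂ R] (D : R → R → R) : Prop :=
  (∀ f g h : R, D (f + g) h = D f h + D g h) ∧
  (∀ f g h : R, D f (g + h) = D f g + D f h) ∧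
  (∀ (c : ℂ) (f g : R), D (c • f) g = c • D f g) ∧
  (∀ (c : ℂ) (f g : R), D f (c • g) = c • D f g) ∧
  (∀ f g h : R, D (f * g) h = f * D g h + D f h * g) ∧
  (∀ f g h : R, D f (g * h) = g * D f h + D f g * h)

namespace Derivation

variable {A R : Type*} [CommRing A] [CommRing R] [Algebra A R] {m : Type*} [Fintype m]

theorem matrix_pow_apply_eq_zero [DecidableEq m] (D : Derivation A R R) {M : Matrix m m R}
    (hM : ∀ i j, D (M i j) = 0) (k : ℕ) (i j : m) : D ((M ^ k) i j) = 0 := by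
  induction k generalizing i j with
  | zero =>
    rw [pow_zero, Matrix.one_apply]
    split_ifs <;> simp
  | succ k ih => simp [pow_succ, Matrix.mul_apply, Derivation.leibniz, hM, ih]

/-- If the entries of `M` are eigenvectors of `D` with eigenvalue `s` and those of `N` are
constants of `D`, then `tr (M * N)` is an eigenvector with eigenvalue `s`. -/
theorem trace_mul_eq (D : Derivation A R R) {M N : Matrix m m R} {s : R}
    (hM : ∀ i j, D (M i j) = s * M i j) (hN : ∀ i j, D (N i j) = 0) :
    D (M * N).trace = s * (M * N).trace := by
  simp only [Matrix.trace, Matrix.diag_apply, Matrix.mul_apply, map_sum, Derivation.leibniz,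
    hM, hN, smul_eq_mul, Finset.mul_sum, mul_zero, zero_add]
  exact Finset.sum_congr rfl fun i _ => Finset.sum_congr rfl fun j _ => by ring

end Derivation

namespace IsCBiderivation

variable {R : Type*} [CommRing R] [Algebra ℂ R] {ψ : R → R → R}

/-- The derivation `f ↦ ψ f r`. -/
def left (h : IsCBiderivation ψ) (r : R) : Derivation ℂ R R :=
  Derivation.mk' ⟨⟨fun f => ψ f r, fun f g => h.1 f g r⟩, fun c f => h.2.2.1 c f r⟩
    fun f g => by
      change ψ (f * g) r = f * ψ g r + g * ψ f r
      rw [h.2.2.2.2.1, mul_comm g]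

/-- The derivation `g ↦ ψ f g`. -/
def right (h : IsCBiderivation ψ) (f : R) : Derivation ℂ R R :=
  Derivation.mk' ⟨⟨fun g => ψ f g, fun g k => h.2.1 f g k⟩, fun c g => h.2.2.2.1 c f g⟩
    fun g k => by
      change ψ f (g * k) = g * ψ f k + k * ψ f g
      rw [h.2.2.2.2.2, mul_comm k]

end IsCBiderivation

/-- **Casimirs and Poisson subalgebras for the bivector `ψ_z` on the spin RS master
phase space** (proof of Proposition 4.7 of the paper): (i) every entry of `W_γ V_γ` is a
Casimir of `ψ`, hence the traces `tr(𝒵_α^k)` of the matrices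
`𝒵_α = Z + Σ_{β≤α} W_β V_β` pairwise `ψ`-commute; (ii) for `t_{k;αβ} = tr(W_α V_β Z^k)`
one has `ψ(t_{k;γε}, t_{l;αβ}) = (z_{γα}+z_{εβ}−z_{γβ}−z_{εα}) t_{k;γε} t_{l;αβ}`. -/
theorem spinRS_integrability_pencil
    {R : Type*} [CommRing R] [Algebra ℂ R] {n d : ℕ} (hn : 1 ≤ n) (hd : 1 ≤ d)
    (Z : Matrix (Fin n) (Fin n) R)
    (W : Fin d → Matrix (Fin n) (Fin 1) R)
    (V : Fin d → Matrix (Fin 1) (Fin n) R)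
    (hgen : Algebra.adjoin ℂ
        ((Set.range fun p : Fin n × Fin n => Z p.1 p.2) ∪
          (Set.range fun p : Fin d × Fin n => W p.1 p.2 0) ∪
          (Set.range fun p : Fin d × Fin n => V p.1 0 p.2)) = ⊤)
    (z : Fin d → Fin d → ℂ) (hz : ∀ α β, z β α = - z α β)
    (ψ : R → R → R) (hbider : IsCBiderivation ψ)
    (hanti : ∀ f g : R, ψ f g = - ψ g f)
    (hZcas : ∀ (i j : Fin n) (r : R), ψ (Z i j) r = 0)
    (hVV : ∀ (α β : Fin d) (i j : Fin n),
      ψ (V α 0 i) (V β 0 j) = z α β • (V α 0 i * V β 0 j))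
    (hWW : ∀ (α β : Fin d) (i j : Fin n),
      ψ (W α i 0) (W β j 0) = z α β • (W α i 0 * W β j 0))
    (hVW : ∀ (α β : Fin d) (i j : Fin n),
      ψ (V α 0 i) (W β j 0) = - z α β • (V α 0 i * W β j 0)) :
    (∀ (γ : Fin d) (i j : Fin n) (r : R), ψ ((W γ * V γ) i j) r = 0) ∧
    (∀ (k l : ℕ), 1 ≤ k → 1 ≤ l → ∀ α β : Fin d,
      ψ (Matrix.trace ((Z + ∑ γ ∈ Finset.univ.filter (· ≤ α), W γ * V γ) ^ k))
        (Matrix.trace ((Z + ∑ γ ∈ Finset.univ.filter (· ≤ β), W γ * V γ) ^ l)) = 0) ∧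
    (∀ (k l : ℕ) (α β γ ε : Fin d),
      ψ (Matrix.trace (W γ * V ε * Z ^ k)) (Matrix.trace (W α * V β * Z ^ l))
        = (z γ α + z ε β - z γ β - z ε α) •
            (Matrix.trace (W γ * V ε * Z ^ k) * Matrix.trace (W α * V β * Z ^ l))) := by
  have hWV : ∀ (α β : Fin d) (i j : Fin n),
      ψ (W α i 0) (V β 0 j) = - z α β • (W α i 0 * V β 0 j) := fun α β i j => by
    rw [hanti, hVW, hz α β, neg_neg, neg_smul, mul_comm]
  have hprod : ∀ γ ε i j, (W γ * V ε) i j = W γ i 0 * V ε 0 j := fun γ ε i j => by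
    simp [Matrix.mul_apply]
  have hmul := hbider.2.2.2.2.1
  have hmul_right := hbider.2.2.2.2.2
  have hcas : ∀ (γ : Fin d) (i j : Fin n) (r : R), ψ ((W γ * V γ) i j) r = 0 := by
    intro γ i j r
    have hD : hbider.right ((W γ * V γ) i j) = 0 := by
      refine Derivation.ext_of_adjoin_eq_top _ hgen ?_
      rintro _ ((⟨p, rfl⟩ | ⟨p, rfl⟩) | ⟨p, rfl⟩)
      · change ψ _ (Z p.1 p.2) = 0
        rw [hanti, hZcas, neg_zero]
      · change ψ _ (W p.1 p.2 0) = 0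
        rw [hprod, hmul, hVW, hWW]
        simp only [Algebra.smul_def, map_neg]
        ring
      · change ψ _ (V p.1 0 p.2) = 0
        rw [hprod, hmul, hVV, hWV]
        simp only [Algebra.smul_def, map_neg]
        ring
    exact congrArg (fun D : Derivation ℂ R R => D r) hD
  refine ⟨hcas, ?_, ?_⟩
  · intro k l _ _ α β
    set r := Matrix.trace ((Z + ∑ γ ∈ Finset.univ.filter (· ≤ β), W γ * V γ) ^ l)
    change hbider.left r (Matrix.trace _) = 0
    have hentry : ∀ i j, hbider.left r
        ((Z + ∑ γ ∈ Finset.univ.filter (· ≤ α), W γ * V γ) i j) = 0 := by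
      intro i j
      rw [Matrix.add_apply, Matrix.sum_apply, map_add, map_sum]
      have hZ : hbider.left r (Z i j) = 0 := hZcas i j r
      rw [hZ, zero_add]
      exact Finset.sum_eq_zero fun γ _ => hcas γ i j r
    rw [Matrix.trace, map_sum]
    exact Finset.sum_eq_zero fun i _ =>
      (hbider.left r).matrix_pow_apply_eq_zero hentry k i i
  · intro k l α β γ ε
    set c : ℂ := z γ α + z ε β - z γ β - z ε α with hc
    have hZpow : ∀ (k : ℕ) (r : R) (i j : Fin n), hbider.left r ((Z ^ k) i j) = 0 :=
      fun k r => (hbider.left r).matrix_pow_apply_eq_zero (fun i j => hZcas i j r) k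
    have hentries : ∀ i j i' j', ψ ((W γ * V ε) i j) ((W α * V β) i' j')
        = c • ((W γ * V ε) i j * (W α * V β) i' j') := by
      intro i j i' j'
      simp only [hprod, hmul, hmul_right, hVV, hWW, hVW, hWV, hc, Algebra.smul_def, map_neg,
        map_sub, map_add]
      ring
    have htrace : ∀ i j, ψ ((W γ * V ε) i j) (W α * V β * Z ^ l).trace
        = algebraMap ℂ R c * (W α * V β * Z ^ l).trace * (W γ * V ε) i j := by
      intro i j
      have h := (hbider.right ((W γ * V ε) i j)).trace_mul_eq (M := W α * V β) (N := Z ^ l)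
        (s := algebraMap ℂ R c * (W γ * V ε) i j)
        (fun i' j' => (hentries i j i' j').trans (by rw [Algebra.smul_def, mul_assoc]))
        (fun i' j' => (hanti _ _).trans (neg_eq_zero.mpr (hZpow l _ i' j')))
      exact h.trans (by ring)
    have h := (hbider.left (W α * V β * Z ^ l).trace).trace_mul_eq (M := W γ * V ε)
      (N := Z ^ k) htrace (hZpow k _)
    exact h.trans (by rw [Algebra.smul_def]; ring)
end

section
/- Let n, d ≥ 1 and let R be a commutative ℂ-algebra generated by the entries of matrices X ∈ Mat_{n×n}(R), A_α ∈ Mat_{n×1}(R) and B_α ∈ Mat_{1×n}(R) for 1 ≤ α ≤ d. Let (z_{αβ})_{1≤α,β≤d} be an antisymmetric complex matrix and ψ : R × R → R an antisymmetric ℂ-bilinear biderivation satisfying: ψ(X_{ij}, r) = 0 for all r ∈ R; ψ((A_α)_i, (A_β)_j) = z_{αβ} (A_α)_i (A_β)_j; ψ((B_α)_i, (B_β)_j) = z_{αβ} (B_α)_i (B_β)_j; ψ((A_α)_i, (B_β)_j) = −z_{αβ} (A_α)_i (B_β)_j. Then, setting f_k := tr(X^k) and g_{αβ;k} := tr(A_α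 B_β X^k): ψ(f_k, f_l) = 0, ψ(f_k, g_{αβ;l}) = 0, and ψ(g_{γε;k}, g_{αβ;l}) = (z_{γα} + z_{εβ} − z_{γβ} − z_{εα}) · g_{γε;k} · g_{αβ;l}. -/
open Finset Matrix

/-- Fixing the second argument of a biderivation gives a derivation. -/
def IsCBiderivation.left_s7 {R : Type*} [CommRing R] [Algebra ℂ R] {D : R → R → R}
    (hD : IsCBiderivation D) (r : R) : Derivation ℂ R R :=
  Derivation.mk'
    { toFun := fun f => D f r
      map_add' := fun f g => hD.1 f g r
      map_smul' := fun c f => hD.2.2.1 c f r }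
    fun f g => by
      simp only [LinearMap.coe_mk, AddHom.coe_mk, smul_eq_mul, hD.2.2.2.2.1]
      ring

/-- Fixing the first argument of a biderivation gives a derivation. -/
def IsCBiderivation.right_s7 {R : Type*} [CommRing R] [Algebra ℂ R] {D : R → R → R}
    (hD : IsCBiderivation D) (r : R) : Derivation ℂ R R :=
  Derivation.mk'
    { toFun := fun f => D r f
      map_add' := fun f g => hD.2.1 r f g
      map_smul' := fun c f => hD.2.2.2.1 c r f }
    fun f g => by
      simp only [LinearMap.coe_mk, AddHom.coe_mk, smul_eq_mul, hD.2.2.2.2.2]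
      ring

/-- A derivation killing the entries of a matrix kills the entries of its powers. -/
lemma Derivation.matrix_pow_apply_eq_zero_s7 {S R m : Type*} [CommRing S] [CommRing R] [Algebra S R]
    [Fintype m] [DecidableEq m] (δ : Derivation S R R) {X : Matrix m m R}
    (hX : ∀ i j, δ (X i j) = 0) (k : ℕ) (i j : m) : δ ((X ^ k) i j) = 0 := by
  induction k generalizing i j with
  | zero => by_cases h : i = j <;> simp [h]
  | succ k ih => simp [pow_succ, Matrix.mul_apply, ih, hX]

/-- A derivation killing the entries of `X`, with the entries of `a` and `b` as eigenvectors of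
eigenvalues `c` and `e`, has `tr (a b X ^ k)` as an eigenvector of eigenvalue `c + e`. -/
lemma Derivation.trace_mul_mul_pow {S R m p : Type*} [CommRing S] [CommRing R] [Algebra S R]
    [Fintype m] [DecidableEq m] [Fintype p] (δ : Derivation S R R) {X : Matrix m m R}
    {a : Matrix m p R} {b : Matrix p m R} {c e : R} (hX : ∀ i j, δ (X i j) = 0)
    (ha : ∀ i j, δ (a i j) = c * a i j) (hb : ∀ i j, δ (b i j) = e * b i j) (k : ℕ) :
    δ (Matrix.trace (a * b * X ^ k)) = (c + e) * Matrix.trace (a * b * X ^ k) := by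
  have hab : ∀ i j, δ ((a * b) i j) = (c + e) * (a * b) i j := fun i j => by
    simp only [Matrix.mul_apply, map_sum, Finset.mul_sum, Derivation.leibniz, ha, hb, smul_eq_mul]
    exact Finset.sum_congr rfl fun _ _ => by ring
  simp only [Matrix.trace, Matrix.diag_apply, Matrix.mul_apply (M := a * b), map_sum,
    Finset.mul_sum, Derivation.leibniz, hab, δ.matrix_pow_apply_eq_zero_s7 hX, smul_eq_mul]
  exact Finset.sum_congr rfl fun _ _ => Finset.sum_congr rfl fun _ _ => by ring

/-- **Values of `ψ_z` on the invariant functions `f_k = tr(X^k)` and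
`g_{αβ;k} = tr(A_α B_β X^k)`** (equations (Eq:psi-fg) in the proof of Lemma 4.3 of the
paper): `ψ(f_k,f_l) = 0`, `ψ(f_k, g_{αβ;l}) = 0`, and
`ψ(g_{γε;k}, g_{αβ;l}) = (z_{γα}+z_{εβ}−z_{γβ}−z_{εα}) g_{γε;k} g_{αβ;l}`. -/
theorem psi_z_on_trace_functions
    {R : Type*} [CommRing R] [Algebra ℂ R] {n d : ℕ} (hn : 1 ≤ n) (hd : 1 ≤ d)
    (X : Matrix (Fin n) (Fin n) R)
    (A : Fin d → Matrix (Fin n) (Fin 1) R)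
    (B : Fin d → Matrix (Fin 1) (Fin n) R)
    (hgen : Algebra.adjoin ℂ
        ((Set.range fun p : Fin n × Fin n => X p.1 p.2) ∪
          (Set.range fun p : Fin d × Fin n => A p.1 p.2 0) ∪
          (Set.range fun p : Fin d × Fin n => B p.1 0 p.2)) = ⊤)
    (z : Fin d → Fin d → ℂ) (hz : ∀ α β, z β α = - z α β)
    (ψ : R → R → R) (hbider : IsCBiderivation ψ)
    (hanti : ∀ f g : R, ψ f g = - ψ g f)
    (hXcas : ∀ (i j : Fin n) (r : R), ψ (X i j) r = 0)
    (hAA : ∀ (α β : Fin d) (i j : Fin n),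
      ψ (A α i 0) (A β j 0) = z α β • (A α i 0 * A β j 0))
    (hBB : ∀ (α β : Fin d) (i j : Fin n),
      ψ (B α 0 i) (B β 0 j) = z α β • (B α 0 i * B β 0 j))
    (hAB : ∀ (α β : Fin d) (i j : Fin n),
      ψ (A α i 0) (B β 0 j) = - z α β • (A α i 0 * B β 0 j)) :
    (∀ k l : ℕ, ψ (Matrix.trace (X ^ k)) (Matrix.trace (X ^ l)) = 0) ∧
    (∀ (k l : ℕ) (α β : Fin d),
      ψ (Matrix.trace (X ^ k)) (Matrix.trace (A α * B β * X ^ l)) = 0) ∧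
    (∀ (k l : ℕ) (α β γ ε : Fin d),
      ψ (Matrix.trace (A γ * B ε * X ^ k)) (Matrix.trace (A α * B β * X ^ l))
        = (z γ α + z ε β - z γ β - z ε α) •
            (Matrix.trace (A γ * B ε * X ^ k) * Matrix.trace (A α * B β * X ^ l))) := by
  have hf : ∀ (k : ℕ) (r : R), ψ (Matrix.trace (X ^ k)) r = 0 := fun k r => by
    change hbider.left_s7 r _ = 0
    simp only [Matrix.trace, Matrix.diag_apply, map_sum]
    exact Finset.sum_eq_zero fun i _ =>
      (hbider.left_s7 r).matrix_pow_apply_eq_zero_s7 (fun i j => hXcas i j r) k i i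
  have hX : ∀ (r : R) (i j : Fin n), ψ r (X i j) = 0 := fun r i j => by
    rw [hanti, hXcas, neg_zero]
  refine ⟨fun k l => hf k _, fun k l α β => hf k _, fun k l α β γ ε => ?_⟩
  set g := Matrix.trace (A α * B β * X ^ l) with hg
  have hA : ∀ i (j : Fin 1), ψ (A γ i j) g = ((z γ α - z γ β) • g) * A γ i j := by
    intro i j
    obtain rfl := Subsingleton.elim j 0
    refine ((hbider.right_s7 (A γ i 0)).trace_mul_mul_pow (c := z γ α • A γ i 0)
      (e := -z γ β • A γ i 0) (hX _) (fun i' j' => ?_) (fun i' j' => ?_) l).trans ?_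
    · obtain rfl := Subsingleton.elim j' 0
      exact (hAA γ α i i').trans (smul_mul_assoc _ _ _).symm
    · obtain rfl := Subsingleton.elim i' 0
      exact (hAB γ β i j').trans (smul_mul_assoc _ _ _).symm
    · simp only [← hg, Algebra.smul_def, map_sub, map_neg]
      ring
  have hB : ∀ (i : Fin 1) j, ψ (B ε i j) g = ((z ε β - z ε α) • g) * B ε i j := by
    intro i j
    obtain rfl := Subsingleton.elim i 0
    refine ((hbider.right_s7 (B ε 0 j)).trace_mul_mul_pow (c := -z ε α • B ε 0 j)
      (e := z ε β • B ε 0 j) (hX _) (fun i' j' => ?_) (fun i' j' => ?_) l).trans ?_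
    · obtain rfl := Subsingleton.elim j' 0
      refine (hanti _ _).trans ?_
      rw [hAB, hz ε α, neg_neg, smul_mul_assoc, neg_smul, mul_comm]
    · obtain rfl := Subsingleton.elim i' 0
      exact (hBB ε β j j').trans (smul_mul_assoc _ _ _).symm
    · simp only [← hg, Algebra.smul_def, map_sub, map_neg]
      ring
  refine ((hbider.left_s7 g).trace_mul_mul_pow (fun i j => hXcas i j g) hA hB k).trans ?_
  simp only [Algebra.smul_def, map_sub, map_add]
  ring
end

section
/- Let n, d ≥ 1, let (z_{αβ})_{1≤α,β≤d} be an antisymmetric complex matrix, and let R be a commutative ℂ-algebra generated by elements x_i (1 ≤ i ≤ n) and a_i^α, b_i^α (1 ≤ i ≤ n, 1 ≤ α ≤ d) satisfying Σ_{α=1}^d a_i^α = 1 for each i. Suppose ψ : R × R → R is an antisymmetric ℂ-bilinear biderivation with ψ(x_i, x_j) = ψ(x_i, a_j^α) = ψ(x_i, b_j^α) = 0, ψ(a_i^α, a_j^β) = G_z(i,j;α,β) a_i^α a_j^β, ψ(a_i^α, b_j^β) = −G_z(i,j;α,β) a_i^α b_j^β, and ψ(b_i^α, b_j^β) = G_z(i,j;α,β)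 b_i^α b_j^β. Then each x_i and each product a_j^α b_j^α (1 ≤ j ≤ n, 1 ≤ α ≤ d) is a Casimir of ψ: ψ(x_i, r) = 0 and ψ(a_j^α b_j^α, r) = 0 for all r ∈ R. -/
open Finset

/-- The function `G_z(i,j;α,β) = z_{αβ} + Σ_μ (z_{μα} a_j^μ − z_{μβ} a_i^μ)
+ Σ_{μ,ν} z_{μν} a_i^μ a_j^ν`. -/
def Gz {R : Type*} [CommRing R] [Algebra ℂ R] {d : ℕ}
    (z : Fin d → Fin d → ℂ) (ai aj : Fin d → R) (α β : Fin d) : R :=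
  z α β • (1 : R) + (∑ μ, (z μ α • aj μ - z μ β • ai μ)) +
    ∑ μ, ∑ ν, z μ ν • (ai μ * aj ν)

/-- A biderivation vanishes at `f` in its second argument as soon as it does on generators. -/
theorem IsCBiderivation.eq_zero_of_adjoin_eq_top {R : Type*} [CommRing R] [Algebra ℂ R]
    {D : R → R → R} (hD : IsCBiderivation D) {s : Set R} (hs : Algebra.adjoin ℂ s = ⊤)
    {f : R} (hf : ∀ g ∈ s, D f g = 0) (r : R) : D f r = 0 := by
  obtain ⟨-, hadd, -, hsmul, -, hmul⟩ := hD
  have hone : D f 1 = 0 := by simpa using hmul f 1 1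
  have hr : r ∈ Algebra.adjoin ℂ s := hs ▸ Algebra.mem_top
  induction hr using Algebra.adjoin_induction with
  | mem g hg => exact hf g hg
  | algebraMap c => rw [Algebra.algebraMap_eq_smul_one, hsmul, hone, smul_zero]
  | add g h _ _ hg hh => rw [hadd, hg, hh, add_zero]
  | mul g h _ _ hg hh => rw [hmul, hg, hh, mul_zero, zero_mul, add_zero]

/-- For antisymmetric `z`, `Gz` is antisymmetric under exchange of both pairs of indices. -/
theorem Gz_swap {R : Type*} [CommRing R] [Algebra ℂ R] {d : ℕ}
    {z : Fin d → Fin d → ℂ} (hz : ∀ α β, z β α = - z α β) (u v : Fin d → R) (α β : Fin d) :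
    Gz z v u β α = - Gz z u v α β := by
  have hlin : ∑ μ, (z μ β • u μ - z μ α • v μ) = -∑ μ, (z μ α • v μ - z μ β • u μ) := by
    simp only [← Finset.sum_neg_distrib, neg_sub]
  have hquad : ∑ μ, ∑ ν, z μ ν • (v μ * u ν) = -∑ μ, ∑ ν, z μ ν • (u μ * v ν) := by
    rw [Finset.sum_comm]
    simp only [← Finset.sum_neg_distrib]
    refine Finset.sum_congr rfl fun μ _ => Finset.sum_congr rfl fun ν _ => ?_
    rw [hz μ ν, neg_smul, mul_comm]
  unfold Gz
  rw [hlin, hquad, hz α β, neg_smul]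
  ring

/-- **Casimirs of the local bivector `ψ_z^loc`** (Lemma 4.4 of the paper): each `x_i`
and each product `a_j^α b_j^α` is a Casimir of the bracket `ψ_z^loc` on the local
parametrization of the trigonometric spin Ruijsenaars–Schneider phase space. -/
theorem casimirs_of_psi_loc
    {R : Type*} [CommRing R] [Algebra ℂ R] {n d : ℕ} (hn : 1 ≤ n) (hd : 1 ≤ d)
    (z : Fin d → Fin d → ℂ) (hz : ∀ α β, z β α = - z α β)
    (x : Fin n → R) (a b : Fin n → Fin d → R)
    (hsum : ∀ i, (∑ α, a i α) = 1)
    (hgen : Algebra.adjoin ℂ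
        (Set.range x ∪ (Set.range fun p : Fin n × Fin d => a p.1 p.2)
          ∪ (Set.range fun p : Fin n × Fin d => b p.1 p.2)) = ⊤)
    (ψ : R → R → R) (hbider : IsCBiderivation ψ)
    (hanti : ∀ f g : R, ψ f g = - ψ g f)
    (hxx : ∀ i j, ψ (x i) (x j) = 0)
    (hxa : ∀ (i j : Fin n) (α : Fin d), ψ (x i) (a j α) = 0)
    (hxb : ∀ (i j : Fin n) (α : Fin d), ψ (x i) (b j α) = 0)
    (haa : ∀ (i j : Fin n) (α β : Fin d),
      ψ (a i α) (a j β) = Gz z (a i) (a j) α β * (a i α * a j β))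
    (hab : ∀ (i j : Fin n) (α β : Fin d),
      ψ (a i α) (b j β) = - (Gz z (a i) (a j) α β * (a i α * b j β)))
    (hbb : ∀ (i j : Fin n) (α β : Fin d),
      ψ (b i α) (b j β) = Gz z (a i) (a j) α β * (b i α * b j β)) :
    (∀ (i : Fin n) (r : R), ψ (x i) r = 0) ∧
    (∀ (j : Fin n) (α : Fin d) (r : R), ψ (a j α * b j α) r = 0) := by
  have hx (i : Fin n) (r : R) : ψ (x i) r = 0 := by
    refine hbider.eq_zero_of_adjoin_eq_top hgen ?_ r
    rintro _ ((⟨j, rfl⟩ | ⟨⟨j, α⟩, rfl⟩) | ⟨⟨j, α⟩, rfl⟩)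
    exacts [hxx i j, hxa i j α, hxb i j α]
  refine ⟨hx, fun j α r => hbider.eq_zero_of_adjoin_eq_top hgen ?_ r⟩
  have hmul := hbider.2.2.2.2.1
  rintro _ ((⟨i, rfl⟩ | ⟨⟨i, β⟩, rfl⟩) | ⟨⟨i, β⟩, rfl⟩)
  · rw [hanti, hx, neg_zero]
  · rw [hmul, hanti (b j α), hab, haa, Gz_swap hz (a j) (a i) α β]
    ring
  · rw [hmul, hbb, hab]
    ring
end

section
/- Let S be a set and y : S × S → ℂ a function with y(s,t) = −y(t,s) for all s, t ∈ S. Then there exists a unique right double bracket ⟨⟨−,−⟩⟩ on the free associative unital ℂ-algebra A = ℂ⟨S⟩ such that ⟨⟨s, t⟩⟩ = y(s,t)·(s ⊗ t) for all generators s, t ∈ S. -/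
open scoped TensorProduct

/-- A *right double bracket* on an associative unital ℂ-algebra `A`: a ℂ-bilinear map
`A × A → A ⊗ A` which is cyclically antisymmetric and a derivation in each argument
for the right `A`-bimodule structures, i.e. for all `f g h`:
`⟨⟨f,g⟩⟩ = −τ⟨⟨g,f⟩⟩`, `⟨⟨f,gh⟩⟩ = (1⊗g)⟨⟨f,h⟩⟩ + ⟨⟨f,g⟩⟩(1⊗h)` and
`⟨⟨fg,h⟩⟩ = (f⊗1)⟨⟨g,h⟩⟩ + ⟨⟨f,h⟩⟩(g⊗1)`. -/
def IsRightDoubleBracket {A : Type*} [Ring A] [Algebra ℂ A]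
    (B : A → A → A ⊗[ℂ] A) : Prop :=
  (∀ f g h : A, B (f + g) h = B f h + B g h) ∧
  (∀ f g h : A, B f (g + h) = B f g + B f h) ∧
  (∀ (c : ℂ) (f g : A), B (c • f) g = c • B f g) ∧
  (∀ (c : ℂ) (f g : A), B f (c • g) = c • B f g) ∧
  (∀ f g : A, B f g = - (TensorProduct.comm ℂ A A) (B g f)) ∧
  (∀ f g h : A, B f (g * h) = ((1 : A) ⊗ₜ[ℂ] g) * B f h + B f g * ((1 : A) ⊗ₜ[ℂ] h)) ∧
  (∀ f g h : A, B (f * g) h = (f ⊗ₜ[ℂ] (1 : A)) * B g h + B f h * (g ⊗ₜ[ℂ] (1 : A)))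

section DerivationAlong

variable {k : Type*} [CommRing k] {A R : Type*} [Ring A] [Algebra k A] [Ring R] [Algebra k R]

/-- `D` is a `k`-linear derivation from `A` to `R`, where `R` is an `A`-bimodule through `φ`. -/
structure IsDerivationAlong (φ : A →ₐ[k] R) (D : A → R) : Prop where
  map_add : ∀ f g, D (f + g) = D f + D g
  map_smul : ∀ (c : k) f, D (c • f) = c • D f
  leibniz : ∀ f g, D (f * g) = φ f * D g + D f * φ g

namespace IsDerivationAlong

variable {φ : A →ₐ[k] R} {D D' : A → R}

theorem map_one (hD : IsDerivationAlong φ D) : D 1 = 0 := by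
  simpa using hD.leibniz 1 1

theorem map_algebraMap (hD : IsDerivationAlong φ D) (c : k) : D (algebraMap k A c) = 0 := by
  rw [Algebra.algebraMap_eq_smul_one, hD.map_smul, hD.map_one, smul_zero]

theorem add (hD : IsDerivationAlong φ D) (hD' : IsDerivationAlong φ D') :
    IsDerivationAlong φ (fun f => D f + D' f) where
  map_add f g := by rw [hD.map_add, hD'.map_add]; abel
  map_smul c f := by rw [hD.map_smul, hD'.map_smul, smul_add]
  leibniz f g := by rw [hD.leibniz, hD'.leibniz]; noncomm_ring

theorem const_smul (hD : IsDerivationAlong φ D) (c : k) :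
    IsDerivationAlong φ (fun f => c • D f) where
  map_add f g := by rw [hD.map_add, smul_add]
  map_smul a f := by rw [hD.map_smul, smul_comm]
  leibniz f g := by rw [hD.leibniz, smul_add, mul_smul_comm, smul_mul_assoc]

theorem const_mul (hD : IsDerivationAlong φ D) {r : R} (hr : ∀ f, Commute r (φ f)) :
    IsDerivationAlong φ (fun f => r * D f) where
  map_add f g := by rw [hD.map_add, mul_add]
  map_smul a f := by rw [hD.map_smul, mul_smul_comm]
  leibniz f g := by
    rw [hD.leibniz, mul_add, ← mul_assoc, (hr f).eq, mul_assoc, mul_assoc]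

theorem mul_const (hD : IsDerivationAlong φ D) {r : R} (hr : ∀ f, Commute r (φ f)) :
    IsDerivationAlong φ (fun f => D f * r) where
  map_add f g := by rw [hD.map_add, add_mul]
  map_smul a f := by rw [hD.map_smul, smul_mul_assoc]
  leibniz f g := by
    rw [hD.leibniz, add_mul, mul_assoc, mul_assoc, ← (hr g).eq, mul_assoc]

theorem neg_comp {R' : Type*} [Ring R'] [Algebra k R'] (hD : IsDerivationAlong φ D)
    (σ : R →ₐ[k] R') : IsDerivationAlong (σ.comp φ) (fun f => -σ (D f)) where
  map_add f g := by rw [hD.map_add, _root_.map_add, neg_add]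
  map_smul a f := by rw [hD.map_smul, _root_.map_smul, smul_neg]
  leibniz f g := by
    rw [hD.leibniz, _root_.map_add, map_mul, map_mul, AlgHom.comp_apply, AlgHom.comp_apply]
    noncomm_ring

/-- Derivations on a free algebra are determined by their values on the generators. -/
theorem freeAlgebra_ext {S : Type*} {φ : FreeAlgebra k S →ₐ[k] R} {D D' : FreeAlgebra k S → R}
    (hD : IsDerivationAlong φ D) (hD' : IsDerivationAlong φ D')
    (h : ∀ s, D (FreeAlgebra.ι k s) = D' (FreeAlgebra.ι k s)) (f : FreeAlgebra k S) :
    D f = D' f := by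
  induction f using FreeAlgebra.induction with
  | grade0 c => rw [hD.map_algebraMap, hD'.map_algebraMap]
  | grade1 s => exact h s
  | mul f g hf hg => rw [hD.leibniz, hD'.leibniz, hf, hg]
  | add f g hf hg => rw [hD.map_add, hD'.map_add, hf, hg]

/-- Values on the generators of a free algebra extend to a derivation. -/
theorem exists_freeAlgebra {S : Type*} (φ : FreeAlgebra k S →ₐ[k] R) (d : S → R) :
    ∃ D : FreeAlgebra k S → R, IsDerivationAlong φ D ∧ ∀ s, D (FreeAlgebra.ι k s) = d s := by
  let F : FreeAlgebra k S →ₐ[k] TrivSqZeroExt R R :=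
    FreeAlgebra.lift k fun s =>
      TrivSqZeroExt.inl (φ (FreeAlgebra.ι k s)) + TrivSqZeroExt.inr (d s)
  have hF : ∀ f, (F f).fst = φ f := by
    have : (TrivSqZeroExt.fstHom k R R).comp F = φ := by
      ext s
      simp [F]
    exact fun f => DFunLike.congr_fun this f
  refine ⟨fun f => (F f).snd, ⟨fun f g => by simp, fun c f => by simp, fun f g => ?_⟩,
    fun s => by simp [F]⟩
  simp [hF]

end IsDerivationAlong

end DerivationAlong

section RightDoubleBracket

open Algebra.TensorProduct

variable {A : Type*} [Ring A] [Algebra ℂ A] {B : A → A → A ⊗[ℂ] A}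

theorem IsRightDoubleBracket.isDerivationAlong_left (hB : IsRightDoubleBracket B) (h : A) :
    IsDerivationAlong (includeLeft : A →ₐ[ℂ] A ⊗[ℂ] A) (fun f => B f h) :=
  ⟨fun f g => hB.1 f g h, fun c f => hB.2.2.1 c f h, fun f g => hB.2.2.2.2.2.2 f g h⟩

theorem IsRightDoubleBracket.isDerivationAlong_right (hB : IsRightDoubleBracket B) (f : A) :
    IsDerivationAlong (includeRight : A →ₐ[ℂ] A ⊗[ℂ] A) (B f) :=
  ⟨hB.2.1 f, fun c g => hB.2.2.2.1 c f g, hB.2.2.2.2.2.1 f⟩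

theorem commute_one_tmul_includeLeft (g f : A) :
    Commute ((1 : A) ⊗ₜ[ℂ] g) ((includeLeft : A →ₐ[ℂ] A ⊗[ℂ] A) f) := by
  simp [Commute, SemiconjBy]

/-- The right double bracket with arbitrary skew-symmetric values on the generators. -/
theorem exists_isRightDoubleBracket {S : Type*}
    (d : S → S → FreeAlgebra ℂ S ⊗[ℂ] FreeAlgebra ℂ S)
    (hd : ∀ s t, d s t = -TensorProduct.comm ℂ _ _ (d t s)) :
    ∃ B : FreeAlgebra ℂ S → FreeAlgebra ℂ S → FreeAlgebra ℂ S ⊗[ℂ] FreeAlgebra ℂ S,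
      IsRightDoubleBracket B ∧
        ∀ s t, B (FreeAlgebra.ι ℂ s) (FreeAlgebra.ι ℂ t) = d s t := by
  choose D hD hDι using fun s => IsDerivationAlong.exists_freeAlgebra
    (includeRight : FreeAlgebra ℂ S →ₐ[ℂ] FreeAlgebra ℂ S ⊗[ℂ] FreeAlgebra ℂ S) (d s)
  choose E hE hEι using fun h => IsDerivationAlong.exists_freeAlgebra
    (includeLeft : FreeAlgebra ℂ S →ₐ[ℂ] FreeAlgebra ℂ S ⊗[ℂ] FreeAlgebra ℂ S) (fun s => D s h)
  have hright : ∀ f, IsDerivationAlong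
      (includeRight : FreeAlgebra ℂ S →ₐ[ℂ] FreeAlgebra ℂ S ⊗[ℂ] FreeAlgebra ℂ S)
      (fun h => E h f) := fun f =>
    { map_add := fun g h => (hE (g + h)).freeAlgebra_ext ((hE g).add (hE h))
        (fun s => by simp only [hEι, (hD s).map_add]) f
      map_smul := fun c g => (hE (c • g)).freeAlgebra_ext ((hE g).const_smul c)
        (fun s => by simp only [hEι, (hD s).map_smul]) f
      leibniz := fun g h => (hE (g * h)).freeAlgebra_ext
        (((hE h).const_mul (commute_one_tmul_includeLeft g)).add
          ((hE g).mul_const (commute_one_tmul_includeLeft h)))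
        (fun s => by simp only [hEι, (hD s).leibniz, includeRight_apply]) f }
  let σ := (Algebra.TensorProduct.comm ℂ (FreeAlgebra ℂ S) (FreeAlgebra ℂ S)).toAlgHom
  have hσl : σ.comp includeLeft = includeRight := by ext; simp [σ]
  have hσr : σ.comp includeRight = includeLeft := by ext; simp [σ]
  have hskew : ∀ f g, E g f = -σ (E f g) := fun f g =>
    (hE g).freeAlgebra_ext (hσr ▸ (hright g).neg_comp σ)
      (fun s => (hright _).freeAlgebra_ext (hσl ▸ (hE _).neg_comp σ)
        (fun t => by simp only [hEι, hDι]; exact hd s t) g) f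
  exact ⟨fun f g => E g f,
    ⟨fun f g h => (hE h).map_add f g, fun f => (hright f).map_add,
      fun c f g => (hE g).map_smul c f, fun c f g => (hright f).map_smul c g, hskew,
      fun f => (hright f).leibniz, fun f g h => (hE h).leibniz f g⟩,
    fun s t => by simp only [hEι, hDι]⟩

/-- A right double bracket on a free algebra is determined by its values on the generators. -/
theorem IsRightDoubleBracket.freeAlgebra_ext {S : Type*}
    {B B' : FreeAlgebra ℂ S → FreeAlgebra ℂ S → FreeAlgebra ℂ S ⊗[ℂ] FreeAlgebra ℂ S}
    (hB : IsRightDoubleBracket B) (hB' : IsRightDoubleBracket B')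
    (h : ∀ s t, B (FreeAlgebra.ι ℂ s) (FreeAlgebra.ι ℂ t) =
      B' (FreeAlgebra.ι ℂ s) (FreeAlgebra.ι ℂ t)) : B = B' := by
  funext f g
  exact (hB.isDerivationAlong_left g).freeAlgebra_ext (hB'.isDerivationAlong_left g)
    (fun s => (hB.isDerivationAlong_right _).freeAlgebra_ext (hB'.isDerivationAlong_right _)
      (h s) g) f

end RightDoubleBracket

/-- **Existence and uniqueness of the right double bracket on a free algebra**
(Lemma 5.1(1) of the paper): for any skewsymmetric `y : S × S → ℂ` there is a unique
right double bracket on `ℂ⟨S⟩` with `⟨⟨s,t⟩⟩ = y(s,t)·(s ⊗ t)` on generators. -/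
theorem free_algebra_right_double_bracket_exists_unique
    {S : Type*} (y : S → S → ℂ) (hy : ∀ s t, y s t = - y t s) :
    ∃! B : FreeAlgebra ℂ S → FreeAlgebra ℂ S → FreeAlgebra ℂ S ⊗[ℂ] FreeAlgebra ℂ S,
      IsRightDoubleBracket B ∧
        ∀ s t : S, B (FreeAlgebra.ι ℂ s) (FreeAlgebra.ι ℂ t)
          = y s t • (FreeAlgebra.ι ℂ s ⊗ₜ[ℂ] FreeAlgebra.ι ℂ t) := by
  obtain ⟨B, hB, hBι⟩ := exists_isRightDoubleBracket
    (fun s t => y s t • (FreeAlgebra.ι ℂ s ⊗ₜ[ℂ] FreeAlgebra.ι ℂ t))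
    (fun s t => by
      rw [hy s t, map_smul, TensorProduct.comm_tmul]
      exact neg_smul (y t s) (FreeAlgebra.ι ℂ s ⊗ₜ[ℂ] FreeAlgebra.ι ℂ t))
  exact ⟨B, ⟨hB, hBι⟩, fun B' hB' =>
    hB'.1.freeAlgebra_ext hB fun s t => (hB'.2 s t).trans (hBι s t).symm⟩
end

section
/- Let A be an associative unital ℂ-algebra carrying a right double bracket ⟨⟨−,−⟩⟩, and define the trilinear map ⟨⟨−,−,−⟩⟩ : A × A × A → A ⊗ A ⊗ A by ⟨⟨f,g,h⟩⟩ := (⟨⟨f,−⟩⟩ ⊗ id_A)(⟨⟨g,h⟩⟩) + τ_{(123)}((⟨⟨g,−⟩⟩ ⊗ id_A)(⟨⟨h,f⟩⟩)) + τ_{(123)}²((⟨⟨h,−⟩⟩ ⊗ id_A)(⟨⟨f,g⟩⟩)), where (⟨⟨f,−⟩⟩ ⊗ id_A)(u ⊗ v) := ⟨⟨f,u⟩⟩ ⊗ v and τ_{(123)} cyclically permutes the three tensor factors. Let A = ℂ⟨S⟩ be the free algebra on a set S, y : S × S → ℂ skewsymmetric, and ⟨⟨−,−⟩⟩ the unique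 right double bracket with ⟨⟨s,t⟩⟩ = y(s,t)·(s ⊗ t) on generators. Then: (i) for all generators s, t, u ∈ S, ⟨⟨s,t,u⟩⟩ = (y(s,t)y(t,u) + y(t,u)y(u,s) + y(u,s)y(s,t))·(s ⊗ t ⊗ u); (ii) the bracket is (12)-weak Poisson, i.e. ⟨⟨f,g,h⟩⟩ = τ_{(12)}(⟨⟨g,f,h⟩⟩) for all f, g, h ∈ A, where τ_{(12)} swaps the first two tensor factors. -/
open scoped TensorProduct

/-- A (bundled, ℂ-bilinear) *right double bracket* on an associative unital ℂ-algebra. -/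
def IsRightDoubleBracketL {A : Type*} [Ring A] [Algebra ℂ A]
    (B : A →ₗ[ℂ] A →ₗ[ℂ] A ⊗[ℂ] A) : Prop :=
  (∀ f g : A, B f g = - (TensorProduct.comm ℂ A A) (B g f)) ∧
  (∀ f g h : A, B f (g * h) = ((1 : A) ⊗ₜ[ℂ] g) * B f h + B f g * ((1 : A) ⊗ₜ[ℂ] h)) ∧
  (∀ f g h : A, B (f * g) h = (f ⊗ₜ[ℂ] (1 : A)) * B g h + B f h * (g ⊗ₜ[ℂ] (1 : A)))

/-- The cyclic permutation `τ_{(123)}` of the triple tensor product: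
`x ⊗ y ⊗ z ↦ z ⊗ x ⊗ y`. -/
noncomputable def cyc123 (A : Type*) [Ring A] [Algebra ℂ A] :
    A ⊗[ℂ] (A ⊗[ℂ] A) ≃ₗ[ℂ] A ⊗[ℂ] (A ⊗[ℂ] A) :=
  ((TensorProduct.comm ℂ A (A ⊗[ℂ] A)).trans (TensorProduct.assoc ℂ A A A)).symm

/-- The transposition `τ_{(12)}` of the triple tensor product:
`x ⊗ y ⊗ z ↦ y ⊗ x ⊗ z`. -/
noncomputable def swap12 (A : Type*) [Ring A] [Algebra ℂ A] :
    A ⊗[ℂ] (A ⊗[ℂ] A) ≃ₗ[ℂ] A ⊗[ℂ] (A ⊗[ℂ] A) :=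
  (TensorProduct.assoc ℂ A A A).symm.trans
    ((TensorProduct.congr (TensorProduct.comm ℂ A A) (LinearEquiv.refl ℂ A)).trans
      (TensorProduct.assoc ℂ A A A))

/-- The trilinear map `⟨⟨f,g,h⟩⟩ = (⟨⟨f,−⟩⟩⊗id)(⟨⟨g,h⟩⟩) + τ_{(123)}((⟨⟨g,−⟩⟩⊗id)(⟨⟨h,f⟩⟩))
+ τ_{(123)}²((⟨⟨h,−⟩⟩⊗id)(⟨⟨f,g⟩⟩))` associated with a right double bracket, where
`(⟨⟨f,−⟩⟩⊗id)(u⊗v) = ⟨⟨f,u⟩⟩⊗v`. -/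
noncomputable def tripleBracket {A : Type*} [Ring A] [Algebra ℂ A]
    (B : A →ₗ[ℂ] A →ₗ[ℂ] A ⊗[ℂ] A) (f g h : A) : A ⊗[ℂ] (A ⊗[ℂ] A) :=
  (TensorProduct.assoc ℂ A A A)
      (TensorProduct.map (B f) (LinearMap.id : A →ₗ[ℂ] A) (B g h))
    + cyc123 A ((TensorProduct.assoc ℂ A A A)
        (TensorProduct.map (B g) (LinearMap.id : A →ₗ[ℂ] A) (B h f)))
    + cyc123 A (cyc123 A ((TensorProduct.assoc ℂ A A A)
        (TensorProduct.map (B h) (LinearMap.id : A →ₗ[ℂ] A) (B f g))))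

section RightDoubleBracket

variable {A : Type*} [Ring A] [Algebra ℂ A] {B : A →ₗ[ℂ] A →ₗ[ℂ] A ⊗[ℂ] A}

@[simp]
lemma cyc123_tmul (a b c : A) :
    cyc123 A (a ⊗ₜ[ℂ] (b ⊗ₜ[ℂ] c)) = c ⊗ₜ[ℂ] (a ⊗ₜ[ℂ] b) := by
  simp [cyc123]

@[simp]
lemma swap12_tmul (a b c : A) :
    swap12 A (a ⊗ₜ[ℂ] (b ⊗ₜ[ℂ] c)) = b ⊗ₜ[ℂ] (a ⊗ₜ[ℂ] c) := by
  simp [swap12]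

/-- The triple bracket of three elements whose pairwise brackets are log-canonical. -/
lemma tripleBracket_of_logCanonical {f g h : A} {a b c : ℂ}
    (hfg : B f g = a • (f ⊗ₜ[ℂ] g)) (hgh : B g h = b • (g ⊗ₜ[ℂ] h))
    (hhf : B h f = c • (h ⊗ₜ[ℂ] f)) :
    tripleBracket B f g h = (a * b + b * c + c * a) • (f ⊗ₜ[ℂ] (g ⊗ₜ[ℂ] h)) := by
  simp only [tripleBracket, hfg, hgh, hhf, map_smul, TensorProduct.map_tmul, LinearMap.id_apply,
    ← TensorProduct.smul_tmul', TensorProduct.assoc_tmul, cyc123_tmul, smul_smul]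
  module

/-- The triple bracket as a trilinear map. -/
lemma tripleBracket_eq_trilinear (B : A →ₗ[ℂ] A →ₗ[ℂ] A ⊗[ℂ] A) :
    ∃ T : A →ₗ[ℂ] A →ₗ[ℂ] A →ₗ[ℂ] A ⊗[ℂ] (A ⊗[ℂ] A),
      ∀ f g h, T f g h = tripleBracket B f g h := by
  refine ⟨LinearMap.mk₂ ℂ (fun f g =>
    { toFun := tripleBracket B f g, map_add' := ?_, map_smul' := ?_ }) ?_ ?_ ?_ ?_, fun _ _ _ => rfl⟩
  all_goals intros
  all_goals try ext
  all_goals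
    simp only [tripleBracket, map_add, map_smul, LinearMap.add_apply, LinearMap.smul_apply,
      TensorProduct.map_add_left, TensorProduct.map_smul_left, LinearMap.coe_mk, AddHom.coe_mk,
      RingHom.id_apply]
    module

namespace IsRightDoubleBracketL

lemma apply_one_right (hB : IsRightDoubleBracketL B) (f : A) : B f 1 = 0 := by
  simpa [← Algebra.TensorProduct.one_def] using hB.2.1 f 1 1

lemma apply_one_left (hB : IsRightDoubleBracketL B) (f : A) : B 1 f = 0 := by
  rw [hB.1, hB.apply_one_right, map_zero, neg_zero]

lemma apply_swap (hB : IsRightDoubleBracketL B) {f g : A} {c : ℂ}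
    (h : B f g = c • (f ⊗ₜ[ℂ] g)) : B g f = (-c) • (g ⊗ₜ[ℂ] f) := by
  rw [hB.1, h, map_smul, TensorProduct.comm_tmul, neg_smul]

/-- A right double bracket which is log-canonical on a set is log-canonical on the submonoid
it generates. -/
lemma exists_eq_smul_tmul_of_mem_closure (hB : IsRightDoubleBracketL B) {s : Set A}
    (hs : ∀ f ∈ s, ∀ g ∈ s, ∃ c : ℂ, B f g = c • (f ⊗ₜ[ℂ] g)) {f g : A}
    (hf : f ∈ Submonoid.closure s) (hg : g ∈ Submonoid.closure s) :
    ∃ c : ℂ, B f g = c • (f ⊗ₜ[ℂ] g) := by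
  induction hf, hg using Submonoid.closure_induction₂ with
  | mem f g hf hg => exact hs f hf g hg
  | one_left g _ => exact ⟨0, by rw [hB.apply_one_left, zero_smul]⟩
  | one_right f _ => exact ⟨0, by rw [hB.apply_one_right, zero_smul]⟩
  | mul_left f g h _ _ _ hf hg =>
    obtain ⟨a, ha⟩ := hf
    obtain ⟨b, hb⟩ := hg
    refine ⟨b + a, ?_⟩
    rw [hB.2.2, ha, hb, mul_smul_comm, smul_mul_assoc, Algebra.TensorProduct.tmul_mul_tmul,
      Algebra.TensorProduct.tmul_mul_tmul, one_mul, mul_one, add_smul]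
  | mul_right f g h _ _ _ hf hg =>
    obtain ⟨a, ha⟩ := hf
    obtain ⟨b, hb⟩ := hg
    refine ⟨b + a, ?_⟩
    rw [hB.2.1, ha, hb, mul_smul_comm, smul_mul_assoc, Algebra.TensorProduct.tmul_mul_tmul,
      Algebra.TensorProduct.tmul_mul_tmul, one_mul, mul_one, add_smul]

/-- A right double bracket which is log-canonical on a generating set of the algebra is
`(12)`-weak Poisson. -/
lemma tripleBracket_eq_swap12 (hB : IsRightDoubleBracketL B) {s : Set A}
    (hs : ∀ f ∈ s, ∀ g ∈ s, ∃ c : ℂ, B f g = c • (f ⊗ₜ[ℂ] g)) (htop : Algebra.adjoin ℂ s = ⊤)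
    (f g h : A) : tripleBracket B f g h = swap12 A (tripleBracket B g f h) := by
  obtain ⟨T, hT⟩ := tripleBracket_eq_trilinear B
  have hspan : Submodule.span ℂ (Submonoid.closure s : Set A) = ⊤ := by
    rw [← Algebra.adjoin_eq_span, htop, Algebra.top_toSubmodule]
  have hmem (x : A) : x ∈ Submodule.span ℂ (Submonoid.closure s : Set A) := hspan ▸ trivial
  simp only [← hT]
  induction hmem f using Submodule.span_induction with
  | zero => simp
  | add _ _ _ _ h₁ h₂ => simp [h₁, h₂]
  | smul _ _ _ h₁ => simp [h₁]
  | mem f hf =>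
  induction hmem g using Submodule.span_induction with
  | zero => simp
  | add _ _ _ _ h₁ h₂ => simp [h₁, h₂]
  | smul _ _ _ h₁ => simp [h₁]
  | mem g hg =>
  induction hmem h using Submodule.span_induction with
  | zero => simp
  | add _ _ _ _ h₁ h₂ => simp [h₁, h₂]
  | smul _ _ _ h₁ => simp [h₁]
  | mem h hh =>
  obtain ⟨a, ha⟩ := hB.exists_eq_smul_tmul_of_mem_closure hs hf hg
  obtain ⟨b, hb⟩ := hB.exists_eq_smul_tmul_of_mem_closure hs hg hh
  obtain ⟨c, hc⟩ := hB.exists_eq_smul_tmul_of_mem_closure hs hh hf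
  rw [hT, hT, tripleBracket_of_logCanonical ha hb hc,
    tripleBracket_of_logCanonical (hB.apply_swap ha) (hB.apply_swap hc) (hB.apply_swap hb),
    map_smul, swap12_tmul]
  congr 1
  ring

end IsRightDoubleBracketL

end RightDoubleBracket

/-- **The free-algebra right double bracket is `(12)`-weak Poisson**
(Lemma 5.1(2) of the paper): for the right double bracket on `ℂ⟨S⟩` with
`⟨⟨s,t⟩⟩ = y(s,t)·(s⊗t)` on generators, (i) on generators
`⟨⟨s,t,u⟩⟩ = (y(s,t)y(t,u) + y(t,u)y(u,s) + y(u,s)y(s,t))·(s⊗t⊗u)`, and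
(ii) `⟨⟨f,g,h⟩⟩ = τ_{(12)}(⟨⟨g,f,h⟩⟩)` for all `f, g, h`. -/
theorem free_algebra_bracket_weak_poisson
    {S : Type*} (y : S → S → ℂ) (hy : ∀ s t, y s t = - y t s)
    (B : FreeAlgebra ℂ S →ₗ[ℂ] FreeAlgebra ℂ S →ₗ[ℂ]
        FreeAlgebra ℂ S ⊗[ℂ] FreeAlgebra ℂ S)
    (hB : IsRightDoubleBracketL B)
    (hgen : ∀ s t : S, B (FreeAlgebra.ι ℂ s) (FreeAlgebra.ι ℂ t)
      = y s t • (FreeAlgebra.ι ℂ s ⊗ₜ[ℂ] FreeAlgebra.ι ℂ t)) :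
    (∀ s t u : S,
      tripleBracket B (FreeAlgebra.ι ℂ s) (FreeAlgebra.ι ℂ t) (FreeAlgebra.ι ℂ u)
        = (y s t * y t u + y t u * y u s + y u s * y s t) •
            (FreeAlgebra.ι ℂ s ⊗ₜ[ℂ] (FreeAlgebra.ι ℂ t ⊗ₜ[ℂ] FreeAlgebra.ι ℂ u))) ∧
    (∀ f g h : FreeAlgebra ℂ S,
      tripleBracket B f g h = swap12 (FreeAlgebra ℂ S) (tripleBracket B g f h)) := by
  refine ⟨fun s t u => tripleBracket_of_logCanonical (hgen s t) (hgen t u) (hgen u s),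
    hB.tripleBracket_eq_swap12 ?_ (FreeAlgebra.adjoin_range_ι ℂ S)⟩
  rintro _ ⟨s, rfl⟩ _ ⟨t, rfl⟩
  exact ⟨y s t, hgen s t⟩
end

section
/- Let S be a set, y : S × S → ℂ skewsymmetric, and ⟨⟨−,−⟩⟩ the unique right double bracket on the free associative ℂ-algebra A = ℂ⟨S⟩ with ⟨⟨s,t⟩⟩ = y(s,t)·(s ⊗ t) on generators. Then for any two words w = s₁ s₂ ··· s_n and w' = t₁ t₂ ··· t_m in the generators (n, m ≥ 1, s_i, t_j ∈ S), one has ⟨⟨w, w'⟩⟩ = (Σ_{i=1}^n Σ_{j=1}^m y(s_i, t_j)) · (w ⊗ w'). -/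
open scoped TensorProduct

namespace IsRightDoubleBracket

variable {A : Type*} [Ring A] [Algebra ℂ A] {B : A → A → A ⊗[ℂ] A}

theorem apply_mul_right (hB : IsRightDoubleBracket B) (f g h : A) :
    B f (g * h) = ((1 : A) ⊗ₜ[ℂ] g) * B f h + B f g * ((1 : A) ⊗ₜ[ℂ] h) :=
  hB.2.2.2.2.2.1 f g h

theorem apply_mul_left (hB : IsRightDoubleBracket B) (f g h : A) :
    B (f * g) h = (f ⊗ₜ[ℂ] (1 : A)) * B g h + B f h * (g ⊗ₜ[ℂ] (1 : A)) :=
  hB.2.2.2.2.2.2 f g h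

theorem apply_one_right (hB : IsRightDoubleBracket B) (f : A) : B f 1 = 0 := by
  simpa [← Algebra.TensorProduct.one_def] using hB.apply_mul_right f 1 1

theorem apply_one_left (hB : IsRightDoubleBracket B) (f : A) : B 1 f = 0 := by
  simpa [← Algebra.TensorProduct.one_def] using hB.apply_mul_left 1 1 f

theorem apply_prod_ofFn_right (hB : IsRightDoubleBracket B) (f : A) {m : ℕ}
    (g : Fin m → A) (c : Fin m → ℂ) (h : ∀ j, B f (g j) = c j • (f ⊗ₜ[ℂ] g j)) :
    B f (List.ofFn g).prod = (∑ j, c j) • (f ⊗ₜ[ℂ] (List.ofFn g).prod) := by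
  induction m with
  | zero => simp [hB.apply_one_right]
  | succ m ih =>
    rw [List.ofFn_succ, List.prod_cons, hB.apply_mul_right, h,
      ih (fun j => g j.succ) (fun j => c j.succ) fun j => h j.succ, Fin.sum_univ_succ,
      mul_smul_comm, smul_mul_assoc, Algebra.TensorProduct.tmul_mul_tmul,
      Algebra.TensorProduct.tmul_mul_tmul, one_mul, mul_one, add_comm, add_smul]

theorem apply_prod_ofFn_left (hB : IsRightDoubleBracket B) (g : A) {n : ℕ}
    (f : Fin n → A) (c : Fin n → ℂ) (h : ∀ i, B (f i) g = c i • (f i ⊗ₜ[ℂ] g)) :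
    B (List.ofFn f).prod g = (∑ i, c i) • ((List.ofFn f).prod ⊗ₜ[ℂ] g) := by
  induction n with
  | zero => simp [hB.apply_one_left]
  | succ n ih =>
    rw [List.ofFn_succ, List.prod_cons, hB.apply_mul_left, h,
      ih (fun i => f i.succ) (fun i => c i.succ) fun i => h i.succ, Fin.sum_univ_succ,
      mul_smul_comm, smul_mul_assoc, Algebra.TensorProduct.tmul_mul_tmul,
      Algebra.TensorProduct.tmul_mul_tmul, one_mul, mul_one, add_comm, add_smul]

end IsRightDoubleBracket

/-- **Value of the free-algebra right double bracket on words**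
(equation (Eq:ThmRep-brVdB) in the proof of Theorem 5.5 of the paper): for the unique
right double bracket on `ℂ⟨S⟩` with `⟨⟨s,t⟩⟩ = y(s,t)·(s⊗t)` on generators, one has
`⟨⟨s₁⋯s_n, t₁⋯t_m⟩⟩ = (Σ_{i,j} y(s_i,t_j)) · (s₁⋯s_n ⊗ t₁⋯t_m)`. -/
theorem free_algebra_right_double_bracket_on_words
    {S : Type*} (y : S → S → ℂ) (hy : ∀ s t, y s t = - y t s)
    (B : FreeAlgebra ℂ S → FreeAlgebra ℂ S → FreeAlgebra ℂ S ⊗[ℂ] FreeAlgebra ℂ S)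
    (hB : IsRightDoubleBracket B)
    (hgen : ∀ s t : S, B (FreeAlgebra.ι ℂ s) (FreeAlgebra.ι ℂ t)
      = y s t • (FreeAlgebra.ι ℂ s ⊗ₜ[ℂ] FreeAlgebra.ι ℂ t))
    {n m : ℕ} (hn : 1 ≤ n) (hm : 1 ≤ m) (as : Fin n → S) (bs : Fin m → S) :
    B (List.ofFn fun i => FreeAlgebra.ι ℂ (as i)).prod
        (List.ofFn fun j => FreeAlgebra.ι ℂ (bs j)).prod
      = (∑ i, ∑ j, y (as i) (bs j)) •
          ((List.ofFn fun i => FreeAlgebra.ι ℂ (as i)).prod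
            ⊗ₜ[ℂ] (List.ofFn fun j => FreeAlgebra.ι ℂ (bs j)).prod) := by
  exact hB.apply_prod_ofFn_left _ _ _ fun i =>
    hB.apply_prod_ofFn_right _ _ _ fun j => hgen (as i) (bs j)
end
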